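/- arXiv:2010.14253 — 4 statements merged into one kernel-verified Lean document; each statement's English description precedes it below -/
import Mathlib

section
/- Let A be a nonzero real m×n matrix. For every vector u ∈ range(Aᵀ) it holds that uᵀ(I − AᵀA/‖A‖_F²)u ≤ ρ‖u‖₂², i.e. ‖u‖₂² − ‖Au‖₂²/‖A‖_F² ≤ (1 − μ/‖A‖_F²)‖u‖₂². -/
open Matrix

/-- Squared Euclidean norm. -/
def sqnorm {n : ℕ} (u : Fin n → ℝ) : ℝ := ∑ i, (u i) ^ 2

/-- Squared Frobenius norm of a matrix. -/
def frob2 {m n : ℕ} (A : Matrix (Fin m) (Fin n) ℝ) : ℝ := ∑ i, ∑ j, (A i j) ^ 2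

/-- `μ` is the smallest nonzero (real) eigenvalue of the matrix `M`. -/
def IsSmallestNonzeroEigenvalue {n : ℕ} (M : Matrix (Fin n) (Fin n) ℝ) (μ : ℝ) : Prop :=
  μ ≠ 0 ∧ (∃ v : Fin n → ℝ, v ≠ 0 ∧ M.mulVec v = μ • v) ∧
    ∀ t : ℝ, t ≠ 0 → (∃ v : Fin n → ℝ, v ≠ 0 ∧ M.mulVec v = t • v) → μ ≤ t

lemma sqnorm_eq_dotProduct {n : ℕ} (u : Fin n → ℝ) : sqnorm u = u ⬝ᵥ u := by
  simp [sqnorm, dotProduct, sq]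

lemma frob2_nonneg {m n : ℕ} (A : Matrix (Fin m) (Fin n) ℝ) : 0 ≤ frob2 A :=
  Finset.sum_nonneg fun _ _ => Finset.sum_nonneg fun _ _ => sq_nonneg _

lemma OrthonormalBasis.sum_dotProduct_mul_dotProduct {ι κ : Type*} [Fintype ι] [Fintype κ]
    (b : OrthonormalBasis ι ℝ (EuclideanSpace ℝ κ)) (x y : κ → ℝ) :
    ∑ i, ((b i).ofLp ⬝ᵥ x) * ((b i).ofLp ⬝ᵥ y) = x ⬝ᵥ y := by
  have h := b.sum_inner_mul_inner (WithLp.toLp 2 x) (WithLp.toLp 2 y)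
  simpa [EuclideanSpace.inner_eq_star_dotProduct, dotProduct_comm] using h

lemma dotProduct_transpose_mul_self_mulVec {m n : Type*} [Fintype m] [Fintype n]
    (A : Matrix m n ℝ) (x y : n → ℝ) :
    x ⬝ᵥ (Aᵀ * A) *ᵥ y = A *ᵥ x ⬝ᵥ A *ᵥ y := by
  rw [← mulVec_mulVec, dotProduct_mulVec, vecMul_transpose]

/-- On the row space of `A`, the smallest nonzero eigenvalue `μ` of `AᵀA` satisfies
`μ‖u‖₂² ≤ ‖Au‖₂²`. -/
lemma IsSmallestNonzeroEigenvalue.mul_sqnorm_le {m n : ℕ} {A : Matrix (Fin m) (Fin n) ℝ} {μ : ℝ}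
    (hμ : IsSmallestNonzeroEigenvalue (Aᵀ * A) μ) {u : Fin n → ℝ}
    (hu : u ∈ Set.range (Aᵀ.mulVec)) : μ * sqnorm u ≤ sqnorm (A *ᵥ u) := by
  obtain ⟨w, hu⟩ := hu
  have hM : (Aᵀ * A).IsHermitian := by
    simpa using isHermitian_conjTranspose_mul_self A
  let b := hM.eigenvectorBasis
  have hb (i) : (Aᵀ * A) *ᵥ (b i).ofLp = hM.eigenvalues i • (b i).ofLp :=
    hM.mulVec_eigenvectorBasis i
  have hcoord (i) : (b i).ofLp ⬝ᵥ (Aᵀ * A) *ᵥ u = hM.eigenvalues i * ((b i).ofLp ⬝ᵥ u) := by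
    rw [dotProduct_transpose_mul_self_mulVec, dotProduct_comm,
      ← dotProduct_transpose_mul_self_mulVec, hb, dotProduct_smul, dotProduct_comm, smul_eq_mul]
  rw [sqnorm_eq_dotProduct, sqnorm_eq_dotProduct, ← dotProduct_transpose_mul_self_mulVec A,
    ← b.sum_dotProduct_mul_dotProduct u u, ← b.sum_dotProduct_mul_dotProduct u, Finset.mul_sum]
  refine Finset.sum_le_sum fun i _ => ?_
  rw [hcoord, mul_left_comm]
  by_cases h0 : hM.eigenvalues i = 0
  · have hA : A *ᵥ (b i).ofLp = 0 := by
      rw [← dotProduct_self_eq_zero, ← dotProduct_transpose_mul_self_mulVec, hb, h0]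
      simp
    have hc : (b i).ofLp ⬝ᵥ u = 0 := by
      rw [← hu, dotProduct_mulVec, vecMul_transpose, hA, zero_dotProduct]
    simp [hc]
  · have hne : (b i).ofLp ≠ 0 := by
      simpa using b.orthonormal.ne_zero i
    have hle := hμ.2.2 _ h0 ⟨_, hne, hb i⟩
    nlinarith [mul_self_nonneg ((b i).ofLp ⬝ᵥ u)]

/-- For a nonzero `A` and every `u` in the row space of `A`,
`uᵀ(I − AᵀA/‖A‖_F²)u = ‖u‖₂² − ‖Au‖₂²/‖A‖_F² ≤ (1 − μ/‖A‖_F²)‖u‖₂²`. -/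
theorem stmt0 {m n : ℕ} (A : Matrix (Fin m) (Fin n) ℝ) (hA : A ≠ 0)
    (μ : ℝ) (hμ : IsSmallestNonzeroEigenvalue (Aᵀ * A) μ)
    (u : Fin n → ℝ) (hu : u ∈ Set.range (Aᵀ.mulVec)) :
    sqnorm u - sqnorm (A.mulVec u) / frob2 A ≤ (1 - μ / frob2 A) * sqnorm u := by
  have h := div_le_div_of_nonneg_right (hμ.mul_sqnorm_le hu) (frob2_nonneg A)
  rw [sub_mul, one_mul, div_mul_eq_mul_div]
  exact sub_le_sub_left h _
end

section
/- Let A be a nonzero real m×n matrix each of whose rows A_{i,:} is nonzero, and write P_i := (A_{i,:})ᵀA_{i,:}/‖A_{i,:}‖₂². Then for every e ∈ range(Aᵀ), Σ_{i=1}^{m} (‖A_{i,:}‖₂²/‖A‖_F²)·‖(I − P_i)e‖₂² ≤ ρ‖e‖₂²; that is, one step of the randomized Kaczmarz projection contracts vectors in the row space of A by the factor ρ in expected squared norm. -/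
open Matrix

/-- Squared Euclidean norm of the `i`-th row of `A`. -/
def rowNorm2 {m n : ℕ} (A : Matrix (Fin m) (Fin n) ℝ) (i : Fin m) : ℝ := ∑ j, (A i j) ^ 2

/-- `(I − P_i)e` where `P_i` is the orthogonal projection onto the span of `(A_{i,:})ᵀ`. -/
noncomputable def projStep {m n : ℕ} (A : Matrix (Fin m) (Fin n) ℝ) (i : Fin m) (e : Fin n → ℝ) :
    Fin n → ℝ :=
  e - ((A.mulVec e i) / rowNorm2 A i) • (fun j => A i j)

/-- On the row space of `A`, the smallest nonzero eigenvalue of `Aᵀ * A` bounds the quadratic form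
of `Aᵀ * A` from below. -/
theorem smallest_eigenvalue_mul_dotProduct_le {m n : ℕ} (A : Matrix (Fin m) (Fin n) ℝ)
    {μ : ℝ} (hμ : IsSmallestNonzeroEigenvalue (Aᵀ * A) μ)
    {e : Fin n → ℝ} (he : e ∈ Set.range (Aᵀ.mulVec)) :
    μ * (e ⬝ᵥ e) ≤ (A *ᵥ e) ⬝ᵥ (A *ᵥ e) := by
  obtain ⟨y, rfl⟩ := he
  set e := Aᵀ *ᵥ y with he
  have hM : (Aᵀ * A).IsHermitian := by
    simpa using Matrix.isHermitian_conjTranspose_mul_self A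
  set b := hM.eigenvectorBasis
  have hb : ∀ j, (Aᵀ * A) *ᵥ (b j).ofLp = hM.eigenvalues j • (b j).ofLp :=
    hM.mulVec_eigenvectorBasis
  have parseval : ∀ x z : Fin n → ℝ,
      x ⬝ᵥ z = ∑ j, (x ⬝ᵥ (b j).ofLp) * ((b j).ofLp ⬝ᵥ z) := by
    intro x z
    have h := b.sum_inner_mul_inner (WithLp.toLp 2 x) (WithLp.toLp 2 z)
    simp only [EuclideanSpace.inner_eq_star_dotProduct, star_trivial] at h
    rw [dotProduct_comm x z, ← h]
    exact Finset.sum_congr rfl fun j _ => by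
      rw [dotProduct_comm x, dotProduct_comm _ z]
  have hsymm : ∀ j, (b j).ofLp ⬝ᵥ ((Aᵀ * A) *ᵥ e)
      = hM.eigenvalues j * ((b j).ofLp ⬝ᵥ e) := by
    intro j
    rw [dotProduct_mulVec, ← mulVec_transpose, transpose_mul, transpose_transpose, hb,
      smul_dotProduct, smul_eq_mul]
  have hAe : (A *ᵥ e) ⬝ᵥ (A *ᵥ e) = e ⬝ᵥ ((Aᵀ * A) *ᵥ e) := by
    rw [← mulVec_mulVec, dotProduct_mulVec e, vecMul_transpose]
  rw [hAe, parseval e e, parseval e, Finset.mul_sum]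
  refine Finset.sum_le_sum fun j _ => ?_
  rw [hsymm, dotProduct_comm e]
  by_cases h0 : hM.eigenvalues j = 0
  · have hker : A *ᵥ (b j).ofLp = 0 := by
      rw [← dotProduct_self_eq_zero, ← vecMul_transpose, ← dotProduct_mulVec, vecMul_transpose,
        mulVec_mulVec, hb, h0, zero_smul, dotProduct_zero]
    have : (b j).ofLp ⬝ᵥ e = 0 := by
      rw [he, dotProduct_mulVec, vecMul_transpose, hker, zero_dotProduct]
    simp [this]
  · have hne : (b j).ofLp ≠ 0 := fun h =>
      b.orthonormal.ne_zero j (by ext i; exact congrFun h i)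
    nlinarith [mul_le_mul_of_nonneg_right (hμ.2.2 _ h0 ⟨_, hne, hb j⟩)
      (mul_self_nonneg ((b j).ofLp ⬝ᵥ e))]

/-- Pythagoras for the projection onto the complement of a nonzero row, weighted by the squared
norm of the row. -/
theorem rowNorm2_mul_sqnorm_projStep {m n : ℕ} (A : Matrix (Fin m) (Fin n) ℝ) (i : Fin m)
    (hr : rowNorm2 A i ≠ 0) (e : Fin n → ℝ) :
    rowNorm2 A i * sqnorm (projStep A i e) = rowNorm2 A i * sqnorm e - (A *ᵥ e) i ^ 2 := by
  have expand : ∀ c : ℝ, sqnorm (e - c • fun j => A i j)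
      = sqnorm e - 2 * c * (A *ᵥ e) i + c ^ 2 * rowNorm2 A i := by
    intro c
    simp only [sqnorm, rowNorm2, mulVec, dotProduct, Finset.mul_sum, ← Finset.sum_sub_distrib,
      ← Finset.sum_add_distrib]
    exact Finset.sum_congr rfl fun j _ => by simp; ring
  rw [projStep, expand]
  field_simp
  ring

/-- One step of the randomized Kaczmarz projection contracts vectors in the row space of `A`
by the factor `ρ = 1 − μ/‖A‖_F²` in expected squared norm. -/
theorem stmt2 {m n : ℕ} (A : Matrix (Fin m) (Fin n) ℝ) (hA : A ≠ 0)
    (hrows : ∀ i, (fun j => A i j) ≠ 0)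
    (μ : ℝ) (hμ : IsSmallestNonzeroEigenvalue (Aᵀ * A) μ)
    (e : Fin n → ℝ) (he : e ∈ Set.range (Aᵀ.mulVec)) :
    ∑ i, (rowNorm2 A i / frob2 A) * sqnorm (projStep A i e)
      ≤ (1 - μ / frob2 A) * sqnorm e := by
  have hr : ∀ i, rowNorm2 A i ≠ 0 := fun i h => hrows i <| by
    funext j
    have := (Finset.sum_eq_zero_iff_of_nonneg fun j _ => sq_nonneg (A i j)).1 h j
      (Finset.mem_univ j)
    simpa using this
  have hF0 : 0 ≤ frob2 A :=
    Finset.sum_nonneg fun i _ => Finset.sum_nonneg fun j _ => sq_nonneg _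
  have hF : frob2 A ≠ 0 := fun h => hA <| by
    ext i
    exact absurd ((Finset.sum_eq_zero_iff_of_nonneg fun i _ =>
      Finset.sum_nonneg fun j _ => sq_nonneg (A i j)).1 h i (Finset.mem_univ i)) (hr i)
  have hsum : ∑ i, (rowNorm2 A i / frob2 A) * sqnorm (projStep A i e)
      = (frob2 A * sqnorm e - (A *ᵥ e) ⬝ᵥ (A *ᵥ e)) / frob2 A := by
    have hfrob : frob2 A = ∑ i, rowNorm2 A i := rfl
    simp only [div_mul_eq_mul_div, rowNorm2_mul_sqnorm_projStep A _ (hr _)]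
    rw [← Finset.sum_div, Finset.sum_sub_distrib, ← Finset.sum_mul, ← hfrob]
    simp only [dotProduct, sq]
  have key := smallest_eigenvalue_mul_dotProduct_le A hμ he
  have hsq : e ⬝ᵥ e = sqnorm e := by simp only [dotProduct, sqnorm, sq]
  rw [hsq] at key
  rw [hsum, one_sub_div hF, div_mul_eq_mul_div]
  exact div_le_div_of_nonneg_right (by linarith) hF0
end

section
/- (Convergence of the randomized double Kaczmarz algorithm.) Let A be a nonzero real m×n matrix all of whose rows A_{i,:} and columns A_{:,j} are nonzero, let b ∈ ℝᵐ and c ∈ ℝⁿ with c ∈ range(Aᵀ). Let z⁰ ∈ b + range(A), let x⁰ ∈ ℝⁿ be arbitrary, let z* be the unique vector with Aᵀz* = c and z⁰ − z* ∈ range(A), and let x* be the unique vector with Ax* = b − z* and x⁰ − x* ∈ range(Aᵀ) (so that AᵀAx* = Aᵀb − c, i.e. x* solves the extended normal equations). Then for every k ≥ 1 the RDK iterates satisfy E[‖x^k − x*‖₂²] ≤ (kρ^k/‖A‖_F²)‖z⁰ − z*‖₂² + ρ^k‖x⁰ − x*‖₂², where the expectation is over all sequences of index pairs ((j₁,i₁),…,(j_k,i_k))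 ∈ ([n]×[m])^k weighted by ∏_{t=1}^{k} (‖A_{:,j_t}‖₂²/‖A‖_F²)(‖A_{i_t,:}‖₂²/‖A‖_F²). -/
open Matrix

/-- Squared Euclidean norm of the `j`-th column of `A`. -/
def colNorm2 {m n : ℕ} (A : Matrix (Fin m) (Fin n) ℝ) (j : Fin n) : ℝ := ∑ i, (A i j) ^ 2

/-- One step of the randomized double Kaczmarz algorithm for `AᵀAx = Aᵀb − c`:
given the index pair `(j, i)`, first update `z` by a Kaczmarz step on `Aᵀz = c` with
column `j`, then update `x` by a Kaczmarz step on `Ax = b − z` with row `i`. -/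
noncomputable def rdkStep {m n : ℕ} (A : Matrix (Fin m) (Fin n) ℝ) (b : Fin m → ℝ)
    (c : Fin n → ℝ) (p : Fin n × Fin m) (s : (Fin m → ℝ) × (Fin n → ℝ)) :
    (Fin m → ℝ) × (Fin n → ℝ) :=
  let z := s.1 - ((Aᵀ.mulVec s.1 p.1 - c p.1) / colNorm2 A p.1) • (fun i => A i p.1)
  (z, s.2 - ((A.mulVec s.2 p.2 - b p.2 + z p.2) / rowNorm2 A p.2) • (fun j => A p.2 j))

lemma sqnorm_nonneg {n : ℕ} (u : Fin n → ℝ) : 0 ≤ sqnorm u :=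
  Finset.sum_nonneg fun _ _ => sq_nonneg _

lemma sqnorm_pos {n : ℕ} {u : Fin n → ℝ} (hu : u ≠ 0) : 0 < sqnorm u := by
  refine (sqnorm_nonneg u).lt_of_ne fun h => hu ?_
  rw [sqnorm_eq_dotProduct] at h
  exact dotProduct_self_eq_zero.mp h.symm

lemma frob2_transpose {m n : ℕ} (A : Matrix (Fin m) (Fin n) ℝ) : frob2 Aᵀ = frob2 A :=
  Finset.sum_comm

lemma frob2_pos {m n : ℕ} {A : Matrix (Fin m) (Fin n) ℝ} (hA : A ≠ 0) : 0 < frob2 A := by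
  obtain ⟨i, hi⟩ : ∃ i, A i ≠ 0 := by
    by_contra! h
    exact hA (funext h)
  exact (sqnorm_pos hi).trans_le
    (Finset.single_le_sum (f := fun i => sqnorm (A i)) (fun i _ => sqnorm_nonneg _)
      (Finset.mem_univ i))

lemma sqnorm_mulVec_le {m n : ℕ} (A : Matrix (Fin m) (Fin n) ℝ) (u : Fin n → ℝ) :
    sqnorm (A *ᵥ u) ≤ frob2 A * sqnorm u := by
  rw [frob2, Finset.sum_mul]
  exact Finset.sum_le_sum fun i _ => Finset.sum_mul_sq_le_sq_mul_sq Finset.univ (A i) u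

lemma sqnorm_mulVec {m n : ℕ} (A : Matrix (Fin m) (Fin n) ℝ) (u : Fin n → ℝ) :
    sqnorm (A *ᵥ u) = u ⬝ᵥ (Aᵀ * A) *ᵥ u := by
  rw [sqnorm_eq_dotProduct, dotProduct_mulVec, vecMul_mulVec, dotProduct_comm, ← mulVec_transpose]
  simp

/-- A lower bound for the nonzero eigenvalues of `AᵀA` bounds `‖Aᵀw‖² / ‖w‖²` from below
on the range of `A`. -/
lemma mul_sqnorm_mulVec_le {m n : ℕ} (A : Matrix (Fin m) (Fin n) ℝ) {μ : ℝ}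
    (hμ : ∀ t : ℝ, t ≠ 0 → (∃ v : Fin n → ℝ, v ≠ 0 ∧ (Aᵀ * A) *ᵥ v = t • v) → μ ≤ t)
    (u : Fin n → ℝ) : μ * sqnorm (A *ᵥ u) ≤ sqnorm (Aᵀ *ᵥ (A *ᵥ u)) := by
  have hpsd : (Aᵀ * A).PosSemidef := by
    simpa using posSemidef_conjTranspose_mul_self A
  have hM := hpsd.isHermitian
  let e : Fin n → Fin n → ℝ := fun i => (hM.eigenvectorBasis i).ofLp
  have he : ∀ i, (Aᵀ * A) *ᵥ e i = hM.eigenvalues i • e i := hM.mulVec_eigenvectorBasis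
  have parseval : ∀ a b : Fin n → ℝ, a ⬝ᵥ b = ∑ i, (a ⬝ᵥ e i) * (b ⬝ᵥ e i) := by
    intro a b
    have h := hM.eigenvectorBasis.sum_inner_mul_inner (WithLp.toLp 2 a) (WithLp.toLp 2 b)
    simp only [EuclideanSpace.inner_eq_star_dotProduct, star_trivial] at h
    rw [dotProduct_comm a b, ← h]
    exact Finset.sum_congr rfl fun i _ => by rw [dotProduct_comm a]
  have hMe : ∀ i, (Aᵀ * A) *ᵥ u ⬝ᵥ e i = hM.eigenvalues i * (u ⬝ᵥ e i) := by
    intro i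
    rw [dotProduct_comm, dotProduct_mulVec, ← mulVec_transpose]
    simp only [transpose_mul, transpose_transpose]
    rw [he, smul_dotProduct, smul_eq_mul, dotProduct_comm]
  rw [sqnorm_mulVec, mulVec_mulVec, sqnorm_eq_dotProduct, parseval, parseval, Finset.mul_sum]
  refine Finset.sum_le_sum fun i _ => ?_
  rw [hMe]
  have h0 : 0 ≤ hM.eigenvalues i := hpsd.eigenvalues_nonneg i
  have h1 : 0 ≤ hM.eigenvalues i * (hM.eigenvalues i - μ) := by
    rcases eq_or_ne (hM.eigenvalues i) 0 with h | h
    · simp [h]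
    · refine mul_nonneg h0 (sub_nonneg.mpr (hμ _ h ⟨e i, fun h0 => ?_, he i⟩))
      exact hM.eigenvectorBasis.orthonormal.ne_zero i ((WithLp.ofLp_eq_zero 2).mp h0)
  nlinarith [mul_nonneg h1 (sq_nonneg (u ⬝ᵥ e i))]

lemma le_eigenvalue_transpose {m n : ℕ} (A : Matrix (Fin m) (Fin n) ℝ) {μ : ℝ}
    (hμ : ∀ t : ℝ, t ≠ 0 → (∃ v : Fin n → ℝ, v ≠ 0 ∧ (Aᵀ * A) *ᵥ v = t • v) → μ ≤ t)
    (t : ℝ) (ht : t ≠ 0) (h : ∃ v : Fin m → ℝ, v ≠ 0 ∧ (Aᵀᵀ * Aᵀ) *ᵥ v = t • v) : μ ≤ t := by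
  obtain ⟨v, hv, hvt⟩ := h
  rw [transpose_transpose, ← mulVec_mulVec] at hvt
  refine hμ t ht ⟨Aᵀ *ᵥ v, fun h0 => ?_, ?_⟩
  · rw [h0, mulVec_zero] at hvt
    exact smul_ne_zero ht hv hvt.symm
  · rw [← mulVec_mulVec, hvt, mulVec_smul]

lemma IsSmallestNonzeroEigenvalue.le_frob2 {m n : ℕ} {A : Matrix (Fin m) (Fin n) ℝ} {μ : ℝ}
    (hμ : IsSmallestNonzeroEigenvalue (Aᵀ * A) μ) : μ ≤ frob2 A := by
  obtain ⟨-, ⟨v, hv, hvμ⟩, -⟩ := hμ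
  have h := sqnorm_mulVec_le A v
  rw [sqnorm_mulVec, hvμ, dotProduct_smul, ← sqnorm_eq_dotProduct, smul_eq_mul] at h
  exact le_of_mul_le_mul_right h (sqnorm_pos hv)

/-- The squared norm after a Kaczmarz step whose right-hand side is perturbed by `t`. -/
lemma sqnorm_kaczmarz {n : ℕ} {a : Fin n → ℝ} (ha : a ≠ 0) (y : Fin n → ℝ) (t : ℝ) :
    sqnorm (y - ((a ⬝ᵥ y + t) / sqnorm a) • a)
      = sqnorm y + (t ^ 2 - (a ⬝ᵥ y) ^ 2) / sqnorm a := by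
  have h := (sqnorm_pos ha).ne'
  simp only [sqnorm_eq_dotProduct] at h ⊢
  simp only [sub_dotProduct, dotProduct_sub, smul_dotProduct, dotProduct_smul, smul_eq_mul,
    dotProduct_comm y a]
  field_simp
  ring

lemma sum_rowNorm2_div {m n : ℕ} {A : Matrix (Fin m) (Fin n) ℝ} (hA : A ≠ 0) :
    ∑ i, rowNorm2 A i / frob2 A = 1 := by
  rw [← Finset.sum_div]
  exact div_self (frob2_pos hA).ne'

/-- Expected squared norm after a Kaczmarz step with a random row of `A`, where the right-hand
side is perturbed by `w`. -/
lemma expected_sqnorm_kaczmarz {m n : ℕ} {A : Matrix (Fin m) (Fin n) ℝ} (hA : A ≠ 0)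
    (hrows : ∀ i, (fun j => A i j) ≠ 0) (y : Fin n → ℝ) (w : Fin m → ℝ) :
    ∑ i, rowNorm2 A i / frob2 A *
        sqnorm (y - (((A *ᵥ y) i + w i) / rowNorm2 A i) • fun j => A i j)
      = sqnorm y + (sqnorm w - sqnorm (A *ᵥ y)) / frob2 A := by
  have h : ∀ i, rowNorm2 A i / frob2 A *
        sqnorm (y - (((A *ᵥ y) i + w i) / rowNorm2 A i) • fun j => A i j)
      = rowNorm2 A i / frob2 A * sqnorm y + (w i ^ 2 - (A *ᵥ y) i ^ 2) / frob2 A := by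
    intro i
    have hr : rowNorm2 A i ≠ 0 := (sqnorm_pos (hrows i)).ne'
    have hs : sqnorm (y - (((A *ᵥ y) i + w i) / rowNorm2 A i) • fun j => A i j)
      = sqnorm y + (w i ^ 2 - (A *ᵥ y) i ^ 2) / rowNorm2 A i := sqnorm_kaczmarz (hrows i) y (w i)
    have hF := (frob2_pos hA).ne'
    rw [hs]
    field_simp
  rw [Finset.sum_congr rfl fun i _ => h i, Finset.sum_add_distrib, ← Finset.sum_mul,
    sum_rowNorm2_div hA, ← Finset.sum_div, Finset.sum_sub_distrib, one_mul]
  rfl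

lemma sub_smul_row_mem_range {m n : ℕ} (A : Matrix (Fin m) (Fin n) ℝ) {y : Fin n → ℝ}
    (hy : y ∈ Set.range Aᵀ.mulVec) (α : ℝ) (i : Fin m) :
    y - α • (fun j => A i j) ∈ Set.range Aᵀ.mulVec := by
  obtain ⟨u, rfl⟩ := hy
  refine ⟨u - α • Pi.single i 1, ?_⟩
  rw [mulVec_sub, mulVec_smul, mulVec_single_one]
  rfl

lemma rdkStep_fst_sub {m n : ℕ} (A : Matrix (Fin m) (Fin n) ℝ) (b : Fin m → ℝ) {c : Fin n → ℝ}
    {zs : Fin m → ℝ} (hzs : Aᵀ *ᵥ zs = c) (p : Fin n × Fin m) (s : (Fin m → ℝ) × (Fin n → ℝ)) :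
    (rdkStep A b c p s).1 - zs
      = (s.1 - zs) - ((Aᵀ *ᵥ (s.1 - zs)) p.1 / colNorm2 A p.1) • fun i => A i p.1 := by
  rw [mulVec_sub, hzs]
  exact sub_right_comm _ _ _

lemma rdkStep_snd_sub {m n : ℕ} (A : Matrix (Fin m) (Fin n) ℝ) {b : Fin m → ℝ} (c : Fin n → ℝ)
    (zs : Fin m → ℝ) {xs : Fin n → ℝ} (hxs : A *ᵥ xs = b - zs)
    (p : Fin n × Fin m) (s : (Fin m → ℝ) × (Fin n → ℝ)) :
    (rdkStep A b c p s).2 - xs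
      = (s.2 - xs) - (((A *ᵥ (s.2 - xs)) p.2 + ((rdkStep A b c p s).1 - zs) p.2) / rowNorm2 A p.2) •
          fun j => A p.2 j := by
  have h : (A *ᵥ (s.2 - xs)) p.2 + ((rdkStep A b c p s).1 - zs) p.2
      = (A *ᵥ s.2) p.2 - b p.2 + (rdkStep A b c p s).1 p.2 := by
    simp only [mulVec_sub, hxs, Pi.sub_apply]
    ring
  rw [h]
  exact sub_right_comm _ _ _

section ErrorBounds

variable {m n : ℕ} {A : Matrix (Fin m) (Fin n) ℝ} {μ : ℝ} {b : Fin m → ℝ} {c : Fin n → ℝ}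
  {zs : Fin m → ℝ} {xs : Fin n → ℝ} {s : (Fin m → ℝ) × (Fin n → ℝ)}

lemma expected_sqnorm_rdkStep_fst_le (hA : A ≠ 0) (hcols : ∀ j, (fun i => A i j) ≠ 0)
    (hμ : IsSmallestNonzeroEigenvalue (Aᵀ * A) μ) (hzs : Aᵀ *ᵥ zs = c)
    (hz : s.1 - zs ∈ Set.range A.mulVec) (i : Fin m) :
    ∑ j, colNorm2 A j / frob2 A * sqnorm ((rdkStep A b c (j, i) s).1 - zs)
      ≤ (1 - μ / frob2 A) * sqnorm (s.1 - zs) := by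
  have hF := frob2_pos hA
  have h := expected_sqnorm_kaczmarz (A := Aᵀ) (by simpa using hA) hcols (s.1 - zs) 0
  simp only [frob2_transpose, Pi.zero_apply, add_zero] at h
  simp only [rdkStep_fst_sub A b hzs]
  refine h.le.trans ?_
  have hlow : μ * sqnorm (s.1 - zs) ≤ sqnorm (Aᵀ *ᵥ (s.1 - zs)) := by
    obtain ⟨u, hu⟩ := hz
    rw [← hu]
    exact mul_sqnorm_mulVec_le A hμ.2.2 u
  have h0 : sqnorm (0 : Fin n → ℝ) = 0 := by simp [sqnorm]
  have := div_le_div_of_nonneg_right hlow hF.le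
  rw [h0, zero_sub, neg_div]
  linarith [mul_div_right_comm μ (sqnorm (s.1 - zs)) (frob2 A)]

lemma expected_sqnorm_rdkStep_snd_le (hA : A ≠ 0) (hrows : ∀ i, (fun j => A i j) ≠ 0)
    (hμ : IsSmallestNonzeroEigenvalue (Aᵀ * A) μ) (hxs : A *ᵥ xs = b - zs)
    (hx : s.2 - xs ∈ Set.range Aᵀ.mulVec) (i₀ : Fin m) (j : Fin n) :
    ∑ i, rowNorm2 A i / frob2 A * sqnorm ((rdkStep A b c (j, i) s).2 - xs)
      ≤ (1 - μ / frob2 A) * sqnorm (s.2 - xs)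
        + sqnorm ((rdkStep A b c (j, i₀) s).1 - zs) / frob2 A := by
  have hF := frob2_pos hA
  have h := expected_sqnorm_kaczmarz hA hrows (s.2 - xs) ((rdkStep A b c (j, i₀) s).1 - zs)
  simp only [rdkStep_snd_sub A c zs hxs]
  refine h.le.trans ?_
  have hlow : μ * sqnorm (s.2 - xs) ≤ sqnorm (A *ᵥ (s.2 - xs)) := by
    obtain ⟨u, hu⟩ := hx
    rw [← hu]
    exact mul_sqnorm_mulVec_le Aᵀ (le_eigenvalue_transpose A hμ.2.2) u
  have := div_le_div_of_nonneg_right hlow hF.le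
  rw [sub_div]
  linarith [mul_div_right_comm μ (sqnorm (s.2 - xs)) (frob2 A)]

/-- The one-step estimate for a combination of the two squared errors. -/
lemma expected_rdkStep_le (hA : A ≠ 0) (hrows : ∀ i, (fun j => A i j) ≠ 0)
    (hcols : ∀ j, (fun i => A i j) ≠ 0) (hμ : IsSmallestNonzeroEigenvalue (Aᵀ * A) μ)
    (hzs : Aᵀ *ᵥ zs = c) (hxs : A *ᵥ xs = b - zs) (hz : s.1 - zs ∈ Set.range A.mulVec)
    (hx : s.2 - xs ∈ Set.range Aᵀ.mulVec) {α β : ℝ} (hα : 0 ≤ α) (hβ : 0 ≤ β) :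
    ∑ p : Fin n × Fin m, colNorm2 A p.1 / frob2 A * (rowNorm2 A p.2 / frob2 A) *
        (α * sqnorm ((rdkStep A b c p s).1 - zs) + β * sqnorm ((rdkStep A b c p s).2 - xs))
      ≤ (α + β / frob2 A) * ((1 - μ / frob2 A) * sqnorm (s.1 - zs))
        + β * ((1 - μ / frob2 A) * sqnorm (s.2 - xs)) := by
  have hF := frob2_pos hA
  obtain ⟨i₀⟩ : Nonempty (Fin m) := by
    by_contra! h
    exact hA (Subsingleton.elim _ _)
  have hinner : ∀ j, ∑ i, colNorm2 A j / frob2 A * (rowNorm2 A i / frob2 A) *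
        (α * sqnorm ((rdkStep A b c (j, i) s).1 - zs)
          + β * sqnorm ((rdkStep A b c (j, i) s).2 - xs))
      ≤ colNorm2 A j / frob2 A * ((α + β / frob2 A) * sqnorm ((rdkStep A b c (j, i₀) s).1 - zs)
          + β * ((1 - μ / frob2 A) * sqnorm (s.2 - xs))) := by
    intro j
    have hsplit : ∑ i, colNorm2 A j / frob2 A * (rowNorm2 A i / frob2 A) *
        (α * sqnorm ((rdkStep A b c (j, i) s).1 - zs)
          + β * sqnorm ((rdkStep A b c (j, i) s).2 - xs))
        = colNorm2 A j / frob2 A * ((∑ i, rowNorm2 A i / frob2 A) *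
            (α * sqnorm ((rdkStep A b c (j, i₀) s).1 - zs))
          + β * ∑ i, rowNorm2 A i / frob2 A * sqnorm ((rdkStep A b c (j, i) s).2 - xs)) := by
      rw [Finset.sum_mul, Finset.mul_sum, ← Finset.sum_add_distrib, Finset.mul_sum]
      refine Finset.sum_congr rfl fun i _ => ?_
      rw [show (rdkStep A b c (j, i) s).1 = (rdkStep A b c (j, i₀) s).1 from rfl]
      ring
    rw [hsplit, sum_rowNorm2_div hA, one_mul]
    refine mul_le_mul_of_nonneg_left ?_ (div_nonneg (sqnorm_nonneg _) hF.le)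
    have := mul_le_mul_of_nonneg_left
      (expected_sqnorm_rdkStep_snd_le (c := c) hA hrows hμ hxs hx i₀ j) hβ
    refine (add_le_add_right this _).trans_eq ?_
    ring
  have hcol : ∑ j, colNorm2 A j / frob2 A = 1 := by
    have := sum_rowNorm2_div (A := Aᵀ) (by simpa using hA)
    rwa [frob2_transpose] at this
  rw [Fintype.sum_prod_type]
  refine (Finset.sum_le_sum fun j _ => hinner j).trans ?_
  simp only [mul_add, Finset.sum_add_distrib, ← Finset.sum_mul, hcol, one_mul]
  refine add_le_add_left ?_ _
  have := mul_le_mul_of_nonneg_left (expected_sqnorm_rdkStep_fst_le (b := b) hA hcols hμ hzs hz i₀)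
    (add_nonneg hα (div_nonneg hβ hF.le))
  refine le_trans (le_of_eq ?_) this
  rw [Finset.mul_sum]
  exact Finset.sum_congr rfl fun j _ => by ring

lemma expected_sqnorm_rdk_le (hA : A ≠ 0) (hrows : ∀ i, (fun j => A i j) ≠ 0)
    (hcols : ∀ j, (fun i => A i j) ≠ 0) (hμ : IsSmallestNonzeroEigenvalue (Aᵀ * A) μ)
    (hzs : Aᵀ *ᵥ zs = c) (hxs : A *ᵥ xs = b - zs) (hz : s.1 - zs ∈ Set.range A.mulVec)
    (hx : s.2 - xs ∈ Set.range Aᵀ.mulVec) (k : ℕ) :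
    ∑ p : Fin k → Fin n × Fin m,
        (∏ t, (colNorm2 A (p t).1 / frob2 A) * (rowNorm2 A (p t).2 / frob2 A)) *
          sqnorm (((List.ofFn p).foldl (fun s q => rdkStep A b c q s) s).2 - xs)
      ≤ (k : ℝ) * (1 - μ / frob2 A) ^ k / frob2 A * sqnorm (s.1 - zs)
        + (1 - μ / frob2 A) ^ k * sqnorm (s.2 - xs) := by
  have hF := frob2_pos hA
  have hρ : 0 ≤ 1 - μ / frob2 A := sub_nonneg.mpr ((div_le_one hF).mpr hμ.le_frob2)
  induction k generalizing s with
  | zero => simp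
  | succ k ih =>
    rw [← (Fin.consEquiv fun _ => Fin n × Fin m).sum_comp, Fintype.sum_prod_type]
    simp only [Fin.consEquiv_apply, Fin.prod_univ_succ, Fin.cons_zero, Fin.cons_succ,
      List.ofFn_succ, List.foldl_cons, mul_assoc _ (∏ _, _), ← Finset.mul_sum]
    have hstep := expected_rdkStep_le hA hrows hcols hμ hzs hxs hz hx
      (α := (k : ℝ) * (1 - μ / frob2 A) ^ k / frob2 A) (β := (1 - μ / frob2 A) ^ k)
      (by positivity) (by positivity)
    refine (Finset.sum_le_sum fun q _ => mul_le_mul_of_nonneg_left (ih ?_ ?_) ?_).trans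
      (hstep.trans_eq ?_)
    · rw [rdkStep_fst_sub A b hzs]
      exact sub_smul_row_mem_range Aᵀ hz _ q.1
    · rw [rdkStep_snd_sub A c zs hxs]
      exact sub_smul_row_mem_range A hx _ q.2
    · exact mul_nonneg (div_nonneg (sqnorm_nonneg _) hF.le) (div_nonneg (sqnorm_nonneg _) hF.le)
    · push_cast
      ring

end ErrorBounds

/-- Convergence of the randomized double Kaczmarz algorithm:
`E[‖x^k − x*‖₂²] ≤ (kρ^k/‖A‖_F²)‖z⁰ − z*‖₂² + ρ^k‖x⁰ − x*‖₂²` with `ρ = 1 − μ/‖A‖_F²`. -/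
theorem stmt9 {m n : ℕ} (A : Matrix (Fin m) (Fin n) ℝ) (hA : A ≠ 0)
    (hrows : ∀ i, (fun j => A i j) ≠ 0) (hcols : ∀ j, (fun i => A i j) ≠ 0)
    (μ : ℝ) (hμ : IsSmallestNonzeroEigenvalue (Aᵀ * A) μ)
    (b : Fin m → ℝ) (c : Fin n → ℝ) (hc : c ∈ Set.range (Aᵀ.mulVec))
    (z0 : Fin m → ℝ) (hz0 : z0 - b ∈ Set.range A.mulVec) (x0 : Fin n → ℝ)
    (zs : Fin m → ℝ) (hzs : Aᵀ.mulVec zs = c) (hz0zs : z0 - zs ∈ Set.range A.mulVec)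
    (xs : Fin n → ℝ) (hxs : A.mulVec xs = b - zs) (hx0xs : x0 - xs ∈ Set.range (Aᵀ.mulVec))
    (k : ℕ) (hk : 1 ≤ k) :
    ∑ p : Fin k → Fin n × Fin m,
        (∏ t, (colNorm2 A (p t).1 / frob2 A) * (rowNorm2 A (p t).2 / frob2 A)) *
          sqnorm (((List.ofFn p).foldl (fun s q => rdkStep A b c q s) (z0, x0)).2 - xs)
      ≤ (k : ℝ) * (1 - μ / frob2 A) ^ k / frob2 A * sqnorm (z0 - zs)
        + (1 - μ / frob2 A) ^ k * sqnorm (x0 - xs) := by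
  exact expected_sqnorm_rdk_le (s := (z0, x0)) hA hrows hcols hμ hzs hxs hz0zs hx0xs k
end

section
/- (Tightness of the RTK bound.) Under the setting of the randomized triple Kaczmarz algorithm, suppose in addition that all nonzero singular values of A are equal, i.e. there is σ > 0 with AAᵀA = σ²A, and set ρ = 1 − σ²/‖A‖_F². Let c ∉ range(Aᵀ), y⁰ ∈ c + range(Aᵀ), z⁰ ∈ b + range(A), x⁰ ∈ ℝⁿ; let y* be the unique vector with Ay* = 0 and y⁰ − y* ∈ range(Aᵀ), z* the unique vector with Aᵀz* = c − y* and z⁰ − z* ∈ range(A), and x* the unique vector with Ax* = b − z* and x⁰ − x* ∈ range(Aᵀ). Then for every k ≥ 1, E[‖x^k − x*‖₂²] = (k(k+1)ρ^k/(2‖A‖_F⁴))‖y⁰ − y*‖₂² + (kρ^k/‖A‖_F²)‖z⁰ − z*‖₂² + ρ^k‖x⁰ − x*‖₂² exactly. -/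
open Matrix

/-- One step of the randomized triple Kaczmarz algorithm for `AᵀAx = Aᵀb − c`:
given the index triple `(l, j, i)`, update `y` by a Kaczmarz step on `Ay = 0` with row `l`,
then `z` by a Kaczmarz step on `Aᵀz = c − y` with column `j`,
then `x` by a Kaczmarz step on `Ax = b − z` with row `i`. -/
noncomputable def rtkStep {m n : ℕ} (A : Matrix (Fin m) (Fin n) ℝ) (b : Fin m → ℝ)
    (c : Fin n → ℝ) (p : Fin m × Fin n × Fin m)
    (s : (Fin n → ℝ) × (Fin m → ℝ) × (Fin n → ℝ)) :
    (Fin n → ℝ) × (Fin m → ℝ) × (Fin n → ℝ) :=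
  let y := s.1 - ((A.mulVec s.1 p.1) / rowNorm2 A p.1) • (fun j => A p.1 j)
  let z := s.2.1 -
    ((Aᵀ.mulVec s.2.1 p.2.1 - c p.2.1 + y p.2.1) / colNorm2 A p.2.1) • (fun i => A i p.2.1)
  (y, z, s.2.2 -
    ((A.mulVec s.2.2 p.2.2 - b p.2.2 + z p.2.2) / rowNorm2 A p.2.2) • (fun j => A p.2.2 j))

/-- A Kaczmarz step from `v` for the system `B v = -r`, using row `i`. -/
noncomputable def kaczmarzStep {p q : ℕ} (B : Matrix (Fin p) (Fin q) ℝ) (r : Fin p → ℝ)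
    (v : Fin q → ℝ) (i : Fin p) : Fin q → ℝ :=
  v - ((B.mulVec v i + r i) / rowNorm2 B i) • (fun j => B i j)

theorem rowNorm2_ne_zero {p q : ℕ} {B : Matrix (Fin p) (Fin q) ℝ} {i : Fin p}
    (h : (fun j => B i j) ≠ 0) : rowNorm2 B i ≠ 0 := by
  intro h0
  apply h
  ext j
  have := (Finset.sum_eq_zero_iff_of_nonneg (fun j _ => sq_nonneg (B i j))).1 h0 j
    (Finset.mem_univ j)
  simpa using this

theorem frob2_transpose_s12 {p q : ℕ} (B : Matrix (Fin p) (Fin q) ℝ) : frob2 Bᵀ = frob2 B :=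
  Finset.sum_comm

theorem frob2_ne_zero {p q : ℕ} {B : Matrix (Fin p) (Fin q) ℝ} (h : B ≠ 0) : frob2 B ≠ 0 := by
  intro h0
  apply h
  ext i j
  have hi := (Finset.sum_eq_zero_iff_of_nonneg
    (fun i _ => Finset.sum_nonneg fun j _ => sq_nonneg (B i j))).1 h0 i (Finset.mem_univ i)
  have hj := (Finset.sum_eq_zero_iff_of_nonneg (fun j _ => sq_nonneg (B i j))).1 hi j
    (Finset.mem_univ j)
  simpa using hj

theorem sqnorm_kaczmarzStep {p q : ℕ} {B : Matrix (Fin p) (Fin q) ℝ} (r : Fin p → ℝ)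
    (v : Fin q → ℝ) {i : Fin p} (h : rowNorm2 B i ≠ 0) :
    rowNorm2 B i * sqnorm (kaczmarzStep B r v i)
      = rowNorm2 B i * sqnorm v - B.mulVec v i ^ 2 + r i ^ 2 := by
  have expand (t : ℝ) : sqnorm (v - t • fun j => B i j)
      = sqnorm v - 2 * t * B.mulVec v i + t ^ 2 * rowNorm2 B i := by
    simp only [sqnorm, rowNorm2, Matrix.mulVec, dotProduct, Finset.mul_sum, Pi.sub_apply,
      Pi.smul_apply, smul_eq_mul]
    rw [← Finset.sum_sub_distrib, ← Finset.sum_add_distrib]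
    exact Finset.sum_congr rfl fun j _ => by ring
  rw [kaczmarzStep, expand]
  field_simp
  ring

/-- On the row space, a matrix with equal nonzero singular values `σ` scales norms by `σ`. -/
theorem sqnorm_mulVec_of_mem_range {p q : ℕ} {B : Matrix (Fin p) (Fin q) ℝ} {σ : ℝ}
    (hB : B * Bᵀ * B = (σ ^ 2) • B) {v : Fin q → ℝ} (hv : v ∈ Set.range Bᵀ.mulVec) :
    sqnorm (B.mulVec v) = σ ^ 2 * sqnorm v := by
  have sq {k : ℕ} (u : Fin k → ℝ) : sqnorm u = u ⬝ᵥ u :=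
    Finset.sum_congr rfl fun _ _ => pow_two _
  have hT : Bᵀ * B * Bᵀ = (σ ^ 2) • Bᵀ := by
    simpa [Matrix.transpose_mul, Matrix.mul_assoc] using congrArg Matrix.transpose hB
  obtain ⟨u, rfl⟩ := hv
  have key : Bᵀ.mulVec (B.mulVec (Bᵀ.mulVec u)) = σ ^ 2 • Bᵀ.mulVec u := by
    rw [Matrix.mulVec_mulVec, Matrix.mulVec_mulVec, hT, Matrix.smul_mulVec]
  rw [sq, sq, Matrix.dotProduct_mulVec, ← Matrix.mulVec_transpose, key, smul_dotProduct,
    smul_eq_mul]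

theorem kaczmarzStep_mem_range {p q : ℕ} {B : Matrix (Fin p) (Fin q) ℝ} (r : Fin p → ℝ)
    {v : Fin q → ℝ} (hv : v ∈ Set.range Bᵀ.mulVec) (i : Fin p) :
    kaczmarzStep B r v i ∈ Set.range Bᵀ.mulVec := by
  obtain ⟨u, rfl⟩ := hv
  refine ⟨u - ((B.mulVec (Bᵀ.mulVec u) i + r i) / rowNorm2 B i) • Pi.single i 1, ?_⟩
  rw [Matrix.mulVec_sub, Matrix.mulVec_smul, Matrix.mulVec_single_one]
  rfl

/-- Exact expected squared norm after one randomized Kaczmarz step. -/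
theorem sum_kaczmarzStep {p q : ℕ} {B : Matrix (Fin p) (Fin q) ℝ}
    (hrows : ∀ i, (fun j => B i j) ≠ 0) (hF : frob2 B ≠ 0) {σ : ℝ}
    (hB : B * Bᵀ * B = (σ ^ 2) • B) (r : Fin p → ℝ) {v : Fin q → ℝ}
    (hv : v ∈ Set.range Bᵀ.mulVec) (a g : ℝ) :
    ∑ i, rowNorm2 B i / frob2 B * (a + g * sqnorm (kaczmarzStep B r v i))
      = a + g * ((1 - σ ^ 2 / frob2 B) * sqnorm v + sqnorm r / frob2 B) := by
  have term (i : Fin p) :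
      rowNorm2 B i / frob2 B * (a + g * sqnorm (kaczmarzStep B r v i))
        = rowNorm2 B i * ((a + g * sqnorm v) / frob2 B)
          - B.mulVec v i ^ 2 * (g / frob2 B) + r i ^ 2 * (g / frob2 B) := by
    have := sqnorm_kaczmarzStep r v (rowNorm2_ne_zero (hrows i))
    field_simp
    linear_combination g * this
  simp only [term, Finset.sum_add_distrib, Finset.sum_sub_distrib, ← Finset.sum_mul]
  change frob2 B * _ - sqnorm (B.mulVec v) * _ + sqnorm r * _ = _
  rw [sqnorm_mulVec_of_mem_range hB hv]
  field_simp
  ring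

/-- Conditioning on the first index in a weighted sum over index sequences. -/
theorem sum_foldl_succ {T S : Type*} [Fintype T] (w : T → ℝ) (step : S → T → S) (f : S → ℝ)
    (k : ℕ) (s : S) :
    ∑ p : Fin (k + 1) → T, (∏ t, w (p t)) * f ((List.ofFn p).foldl step s)
      = ∑ q, w q * ∑ p : Fin k → T, (∏ t, w (p t)) * f ((List.ofFn p).foldl step (step s q)) := by
  rw [← (Fin.consEquiv fun _ : Fin (k + 1) => T).sum_comp, Fintype.sum_prod_type]
  refine Finset.sum_congr rfl fun q _ => ?_
  rw [Finset.mul_sum]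
  refine Finset.sum_congr rfl fun p _ => ?_
  simp [Fin.consEquiv, Fin.prod_univ_succ, List.ofFn_succ, mul_assoc]

/-- The errors of an RTK step are obtained by three Kaczmarz steps. -/
theorem rtkStep_sub {m n : ℕ} {A : Matrix (Fin m) (Fin n) ℝ} {b : Fin m → ℝ} {c : Fin n → ℝ}
    {ys : Fin n → ℝ} (hys : A.mulVec ys = 0) {zs : Fin m → ℝ} (hzs : Aᵀ.mulVec zs = c - ys)
    {xs : Fin n → ℝ} (hxs : A.mulVec xs = b - zs) (l : Fin m) (j : Fin n) (i : Fin m)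
    (y : Fin n → ℝ) (z : Fin m → ℝ) (x : Fin n → ℝ) :
    (rtkStep A b c (l, j, i) (y, z, x)).1 - ys = kaczmarzStep A 0 (y - ys) l ∧
    (rtkStep A b c (l, j, i) (y, z, x)).2.1 - zs
      = kaczmarzStep Aᵀ (kaczmarzStep A 0 (y - ys) l) (z - zs) j ∧
    (rtkStep A b c (l, j, i) (y, z, x)).2.2 - xs
      = kaczmarzStep A (kaczmarzStep Aᵀ (kaczmarzStep A 0 (y - ys) l) (z - zs) j) (x - xs) i := by
  have h1 : (rtkStep A b c (l, j, i) (y, z, x)).1 - ys = kaczmarzStep A 0 (y - ys) l := by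
    simp only [rtkStep, kaczmarzStep, Matrix.mulVec_sub, hys, sub_zero, Pi.zero_apply, add_zero]
    abel
  have h2 : (rtkStep A b c (l, j, i) (y, z, x)).2.1 - zs
      = kaczmarzStep Aᵀ (kaczmarzStep A 0 (y - ys) l) (z - zs) j := by
    rw [← h1]
    simp only [rtkStep, kaczmarzStep, Matrix.mulVec_sub, hzs]
    rw [sub_right_comm]
    congr 2
    change _ / rowNorm2 Aᵀ j = _
    congr 1
    simp only [Pi.sub_apply]
    ring
  refine ⟨h1, h2, ?_⟩
  rw [← h2]
  simp only [rtkStep, kaczmarzStep, Matrix.mulVec_sub, hxs]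
  rw [sub_right_comm]
  congr 3
  simp only [Pi.sub_apply]
  ring

/-- Tightness of the RTK bound: if all nonzero singular values of `A` are equal
(`AAᵀA = σ²A` with `σ > 0`, `ρ = 1 − σ²/‖A‖_F²`), then
`E[‖x^k − x*‖₂²] = (k(k+1)ρ^k/(2‖A‖_F⁴))‖y⁰ − y*‖₂² + (kρ^k/‖A‖_F²)‖z⁰ − z*‖₂²
 + ρ^k‖x⁰ − x*‖₂²` exactly. -/
theorem stmt12 {m n : ℕ} (A : Matrix (Fin m) (Fin n) ℝ) (hA : A ≠ 0)
    (hrows : ∀ i, (fun j => A i j) ≠ 0) (hcols : ∀ j, (fun i => A i j) ≠ 0)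
    (σ : ℝ) (hσ : 0 < σ) (hsing : A * Aᵀ * A = (σ ^ 2) • A)
    (b : Fin m → ℝ) (c : Fin n → ℝ) (hc : c ∉ Set.range (Aᵀ.mulVec))
    (y0 : Fin n → ℝ) (hy0 : y0 - c ∈ Set.range (Aᵀ.mulVec))
    (z0 : Fin m → ℝ) (hz0 : z0 - b ∈ Set.range A.mulVec) (x0 : Fin n → ℝ)
    (ys : Fin n → ℝ) (hys : A.mulVec ys = 0) (hy0ys : y0 - ys ∈ Set.range (Aᵀ.mulVec))
    (zs : Fin m → ℝ) (hzs : Aᵀ.mulVec zs = c - ys) (hz0zs : z0 - zs ∈ Set.range A.mulVec)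
    (xs : Fin n → ℝ) (hxs : A.mulVec xs = b - zs) (hx0xs : x0 - xs ∈ Set.range (Aᵀ.mulVec))
    (k : ℕ) (hk : 1 ≤ k) :
    ∑ p : Fin k → Fin m × Fin n × Fin m,
        (∏ t, (rowNorm2 A (p t).1 / frob2 A) * ((colNorm2 A (p t).2.1 / frob2 A) *
            (rowNorm2 A (p t).2.2 / frob2 A))) *
          sqnorm (((List.ofFn p).foldl (fun s q => rtkStep A b c q s) (y0, z0, x0)).2.2 - xs)
      = (k : ℝ) * ((k : ℝ) + 1) * (1 - σ ^ 2 / frob2 A) ^ k / (2 * (frob2 A) ^ 2) *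
            sqnorm (y0 - ys)
        + (k : ℝ) * (1 - σ ^ 2 / frob2 A) ^ k / frob2 A * sqnorm (z0 - zs)
        + (1 - σ ^ 2 / frob2 A) ^ k * sqnorm (x0 - xs) := by
  have hF : frob2 A ≠ 0 := frob2_ne_zero hA
  have hFT : frob2 Aᵀ ≠ 0 := by rwa [frob2_transpose_s12]
  have hsingT : Aᵀ * Aᵀᵀ * Aᵀ = (σ ^ 2) • Aᵀ := by
    simpa [Matrix.transpose_mul, Matrix.mul_assoc] using congrArg Matrix.transpose hsing
  clear hk hy0 hz0
  induction k generalizing y0 z0 x0 with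
  | zero => simp
  | succ k ih =>
    rw [sum_foldl_succ (fun q : Fin m × Fin n × Fin m => rowNorm2 A q.1 / frob2 A *
      (colNorm2 A q.2.1 / frob2 A * (rowNorm2 A q.2.2 / frob2 A)))
      (fun s q => rtkStep A b c q s) (fun s => sqnorm (s.2.2 - xs))]
    simp only [Fintype.sum_prod_type]
    have inner (l : Fin m) (j : Fin n) (i : Fin m) := by
      obtain ⟨h1, h2, h3⟩ := rtkStep_sub hys hzs hxs l j i y0 z0 x0
      have r1 := kaczmarzStep_mem_range 0 hy0ys l
      have r2 := kaczmarzStep_mem_range (B := Aᵀ) (kaczmarzStep A 0 (y0 - ys) l) hz0zs j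
      have r3 := kaczmarzStep_mem_range
        (kaczmarzStep Aᵀ (kaczmarzStep A 0 (y0 - ys) l) (z0 - zs) j) hx0xs i
      rw [← h1] at r1
      rw [Matrix.transpose_transpose, ← h2] at r2
      rw [← h3] at r3
      have := ih _ _ _ r1 r2 r3
      rwa [h1, h2, h3] at this
    simp only [Prod.mk.eta] at inner
    simp only [inner, mul_assoc (_ / frob2 A), ← Finset.mul_sum]
    set F := frob2 A with hFdef
    have sumX (r : Fin m → ℝ) (a g : ℝ) := sum_kaczmarzStep hrows hF hsing r hx0xs a g
    have sumY (a g : ℝ) := sum_kaczmarzStep hrows hF hsing 0 hy0ys a g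
    have sumZ (r : Fin n → ℝ) (a g : ℝ) : ∑ j, colNorm2 A j / F *
        (a + g * sqnorm (kaczmarzStep Aᵀ r (z0 - zs) j))
          = a + g * ((1 - σ ^ 2 / F) * sqnorm (z0 - zs) + sqnorm r / F) := by
      have := sum_kaczmarzStep (B := Aᵀ) hcols hFT hsingT r hz0zs a g
      rwa [frob2_transpose_s12] at this
    rw [← hFdef] at sumX sumY
    simp only [sumX]
    set ρ := 1 - σ ^ 2 / F
    have regroupZ (Y Z X : ℝ) : (k : ℝ) * ((k : ℝ) + 1) * ρ ^ k / (2 * F ^ 2) * Y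
        + (k : ℝ) * ρ ^ k / F * Z + ρ ^ k * (ρ * X + Z / F)
        = ((k : ℝ) * ((k : ℝ) + 1) * ρ ^ k / (2 * F ^ 2) * Y + ρ ^ (k + 1) * X)
          + ((k : ℝ) + 1) * ρ ^ k / F * Z := by
      field_simp
      ring
    simp only [regroupZ, sumZ]
    have regroupY (Y Z X : ℝ) : (k : ℝ) * ((k : ℝ) + 1) * ρ ^ k / (2 * F ^ 2) * Y
        + ρ ^ (k + 1) * X + ((k : ℝ) + 1) * ρ ^ k / F * (ρ * Z + Y / F)
        = (((k : ℝ) + 1) * ρ ^ (k + 1) / F * Z + ρ ^ (k + 1) * X)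
          + ((k : ℝ) + 1) * ((k : ℝ) + 2) * ρ ^ k / (2 * F ^ 2) * Y := by
      field_simp
      ring
    simp only [regroupY, sumY]
    have sqnorm_zero : sqnorm (0 : Fin m → ℝ) = 0 := by simp [sqnorm]
    rw [sqnorm_zero]
    push_cast
    ring
end
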